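/- Let U = {−u_1, −u_2, −u_3, ...} with u_1 < u_2 < u_3 < ⋯. Define U^{(1)} = U and, for each i ≥ 1, U^{(i+1)} = U^{(i)} \ {−u_i} if (U^{(i)} \ {−u_i}) + 𝒱 = ℤ, and U^{(i+1)} = U^{(i)} otherwise; let 𝒰 = ⋂_{i≥1} U^{(i)}. Then (𝒰, 𝒱) is a co-minimal pair in ℤ. -/

import Mathlib

open scoped Pointwise

/-- Nonempty subsets `A`, `B` of an abelian group `G` form a *co-minimal pair* if
`A + B = G`, no nonempty proper subset of `A` is an additive complement of `B`,
and no nonempty proper subset of `B` is an additive complement of `A`. -/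
def IsCoMinimalPair {G : Type*} [AddCommGroup G] (A B : Set G) : Prop :=
  A.Nonempty ∧ B.Nonempty ∧ A + B = Set.univ ∧
    (∀ A' : Set G, A'.Nonempty → A' ⊂ A → A' + B ≠ Set.univ) ∧
    (∀ B' : Set G, B'.Nonempty → B' ⊂ B → A + B' ≠ Set.univ)

/-- `𝒱 = {2^n : n ≥ 0} ∪ {−2^n : n ≥ 0}`. -/
def Vset : Set ℤ := {x | ∃ n : ℕ, x = 2 ^ n ∨ x = -(2 ^ n)}

/-- The sets `U_n`: `U_0 = {−2, −1}`, `U_1 = U_2 = ∅`, `U_3 = {6} − (1 + 2^4)`,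
`U_4 = {3, 4, 14} − (1 + 2^5)`, and for `n ≥ 5`,
`U_n = ((2^(n−3) + {1, ..., 2^(n−3)}) ∪ (2^(n−1) + 2^(n−2) + {1, ..., 2^(n−4)})) − (1 + 2^(n+1))`. -/
def Useq : ℕ → Set ℤ
  | 0 => {-2, -1}
  | 1 => ∅
  | 2 => ∅
  | 3 => {6 - (1 + 2 ^ 4)}
  | 4 => (fun x => x - (1 + 2 ^ 5)) '' {3, 4, 14}
  | n + 5 => (fun x => x - (1 + 2 ^ (n + 6))) ''
      (Set.Icc ((2 : ℤ) ^ (n + 2) + 1) (2 ^ (n + 2) + 2 ^ (n + 2)) ∪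
       Set.Icc ((2 : ℤ) ^ (n + 4) + 2 ^ (n + 3) + 1) (2 ^ (n + 4) + 2 ^ (n + 3) + 2 ^ (n + 1)))

/-- `U = ⋃_{n ≥ 0} U_n`. -/
def Uset : Set ℤ := ⋃ n, Useq n

/-- Membership in `U`, with the generic blocks rescaled by `q = 2 ^ (k + 1)`. -/
theorem mem_Uset_iff (a : ℤ) : a ∈ Uset ↔
    (a = -1 ∨ a = -2 ∨ a = -11 ∨ a = -19 ∨ a = -29 ∨ a = -30) ∨
    ∃ k : ℕ, (-(30 * 2 ^ (k + 1)) ≤ a ∧ a < -(28 * 2 ^ (k + 1))) ∨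
      (-(20 * 2 ^ (k + 1)) ≤ a ∧ a < -(19 * 2 ^ (k + 1))) := by
  simp only [Uset, Set.mem_iUnion]
  constructor
  · rintro ⟨n, hn⟩
    match n, hn with
    | 0, hn => simp only [Useq, Set.mem_insert_iff, Set.mem_singleton_iff] at hn; omega
    | 1, hn => simp [Useq] at hn
    | 2, hn => simp [Useq] at hn
    | 3, hn => simp only [Useq, Set.mem_singleton_iff] at hn; omega
    | 4, hn =>
      simp only [Useq, Set.mem_image, Set.mem_insert_iff, Set.mem_singleton_iff] at hn
      obtain ⟨x, hx, rfl⟩ := hn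
      omega
    | k + 5, hn =>
      simp only [Useq, Set.mem_image, Set.mem_union, Set.mem_Icc] at hn
      obtain ⟨x, hx, rfl⟩ := hn
      right
      refine ⟨k, ?_⟩
      simp only [pow_add] at hx ⊢
      omega
  · rintro (h | ⟨k, h⟩)
    · rcases h with rfl | rfl | rfl | rfl | rfl | rfl
      · exact ⟨0, by simp [Useq]⟩
      · exact ⟨0, by simp [Useq]⟩
      · exact ⟨3, by norm_num [Useq]⟩
      · exact ⟨4, by norm_num [Useq]⟩
      · exact ⟨4, by norm_num [Useq]⟩
      · exact ⟨4, by norm_num [Useq]⟩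
    · refine ⟨k + 5, ?_⟩
      simp only [Useq, Set.mem_image, Set.mem_union, Set.mem_Icc]
      refine ⟨a + (1 + 2 ^ (k + 6)), ?_, by ring⟩
      simp only [pow_add] at h ⊢
      omega

theorem two_pow_trichotomy (i j : ℕ) :
    (2 : ℤ) ^ i = 2 ^ j ∨ 2 * (2 : ℤ) ^ i ≤ 2 ^ j ∨ 2 * (2 : ℤ) ^ j ≤ 2 ^ i := by
  rcases lt_trichotomy i j with h | h | h
  · right; left
    rw [← pow_succ']
    exact pow_le_pow_right₀ (by norm_num) h
  · left; rw [h]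
  · right; right
    rw [← pow_succ']
    exact pow_le_pow_right₀ (by norm_num) h

theorem two_pow_mem_Vset (n : ℕ) : (2 : ℤ) ^ n ∈ Vset := ⟨n, Or.inl rfl⟩

theorem neg_two_pow_mem_Vset (n : ℕ) : -(2 : ℤ) ^ n ∈ Vset := ⟨n, Or.inr rfl⟩

theorem mem_add_of_sub_mem {A B : Set ℤ} {z v : ℤ} (hv : v ∈ B) (h : z - v ∈ A) : z ∈ A + B :=
  Set.mem_add.2 ⟨z - v, h, v, hv, by ring⟩

theorem exists_two_pow_lt_le {w : ℤ} (hw : 64 < w) :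
    ∃ k : ℕ, 32 * (2 : ℤ) ^ (k + 1) < w ∧ w ≤ 64 * 2 ^ (k + 1) := by
  have hex : ∃ k : ℕ, w ≤ 64 * 2 ^ (k + 1) := by
    obtain ⟨n, hn⟩ := pow_unbounded_of_one_lt w (by norm_num : (1 : ℤ) < 2)
    refine ⟨n, ?_⟩
    have : (0 : ℤ) < 2 ^ n := by positivity
    rw [pow_succ]
    omega
  classical
  refine ⟨Nat.find hex, ?_, Nat.find_spec hex⟩
  rcases h : Nat.find hex with _ | k
  · omega
  · have := Nat.find_min hex (m := k) (by omega)
    simp only [pow_succ] at this ⊢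
    omega

theorem exists_two_pow_le_lt {z : ℤ} (hz : 4 ≤ z) :
    ∃ k : ℕ, 2 * (2 : ℤ) ^ (k + 1) ≤ z ∧ z < 4 * 2 ^ (k + 1) := by
  obtain ⟨k, h₁, h₂⟩ := exists_two_pow_lt_le (w := 16 * z + 1) (by omega)
  refine ⟨k, ?_, ?_⟩ <;> simp only [pow_succ] at * <;> omega

theorem mem_Uset_add_Vset_of_pos {z : ℤ} (hz : 4 ≤ z) : z ∈ Uset + Vset := by
  obtain ⟨k, h₁, h₂⟩ := exists_two_pow_le_lt hz
  refine mem_add_of_sub_mem (two_pow_mem_Vset (k + 6)) ((mem_Uset_iff _).2 (Or.inr ⟨k, Or.inl ?_⟩))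
  simp only [pow_add] at *
  omega

/-- Integers below `-64` are covered, by splitting `(16 q, 32 q]`, `q = 2 ^ (k + 2)`, according to
the translate of a block of `U` that is used. -/
theorem mem_Uset_add_Vset_of_neg {z : ℤ} (hz : z < -64) : z ∈ Uset + Vset := by
  obtain ⟨k, h₁, h₂⟩ := exists_two_pow_lt_le (w := -z) (by omega)
  have hpos : (0 : ℤ) < 2 ^ k := by positivity
  have key : ∀ v ∈ Vset, ∀ j : ℕ, ((-(30 * 2 ^ (j + 1)) ≤ z - v ∧ z - v < -(28 * 2 ^ (j + 1))) ∨
      (-(20 * 2 ^ (j + 1)) ≤ z - v ∧ z - v < -(19 * 2 ^ (j + 1)))) → z ∈ Uset + Vset :=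
    fun v hv j h => mem_add_of_sub_mem hv ((mem_Uset_iff _).2 (Or.inr ⟨j, h⟩))
  have q₁ := key _ (neg_two_pow_mem_Vset (k + 3)) k
  have q₂ := key _ (two_pow_mem_Vset (k + 3)) (k + 1)
  have q₃ := key _ (neg_two_pow_mem_Vset (k + 4)) k
  have q₄ := key _ (two_pow_mem_Vset 0) (k + 1)
  have q₅ := key _ (neg_two_pow_mem_Vset 0) (k + 1)
  have q₆ := key _ (two_pow_mem_Vset (k + 5)) (k + 1)
  have q₇ := key _ (neg_two_pow_mem_Vset (k + 5)) k
  have q₈ := key _ (neg_two_pow_mem_Vset (k + 4)) (k + 1)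
  have q₉ := key _ (two_pow_mem_Vset (k + 4)) (k + 1)
  have q₁₀ := key _ (neg_two_pow_mem_Vset (k + 3)) (k + 1)
  by_contra hcon
  simp only [hcon, imp_false, pow_add] at *
  omega

set_option maxRecDepth 10000 in
theorem exists_sub_mem_blocks_of_small : ∀ z ∈ Finset.Icc (-64 : ℤ) 3, ∃ n < 7,
    (z - 2 ^ n ∈ ({-1, -2, -11, -19, -29, -30} : Finset ℤ) ∨
      ∃ k < 3, (-(30 * 2 ^ (k + 1)) ≤ z - 2 ^ n ∧ z - 2 ^ n < -(28 * 2 ^ (k + 1))) ∨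
        (-(20 * 2 ^ (k + 1)) ≤ z - 2 ^ n ∧ z - 2 ^ n < -(19 * 2 ^ (k + 1)))) ∨
    (z - -2 ^ n ∈ ({-1, -2, -11, -19, -29, -30} : Finset ℤ) ∨
      ∃ k < 3, (-(30 * 2 ^ (k + 1)) ≤ z - -2 ^ n ∧ z - -2 ^ n < -(28 * 2 ^ (k + 1))) ∨
        (-(20 * 2 ^ (k + 1)) ≤ z - -2 ^ n ∧ z - -2 ^ n < -(19 * 2 ^ (k + 1)))) := by
  decide

theorem Uset_add_Vset : Uset + Vset = Set.univ := by
  refine Set.eq_univ_of_forall fun z => ?_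
  by_cases h₁ : 4 ≤ z
  · exact mem_Uset_add_Vset_of_pos h₁
  by_cases h₂ : z < -64
  · exact mem_Uset_add_Vset_of_neg h₂
  obtain ⟨n, -, h⟩ := exists_sub_mem_blocks_of_small z (Finset.mem_Icc.2 (by omega))
  have block : ∀ a : ℤ, (a ∈ ({-1, -2, -11, -19, -29, -30} : Finset ℤ) ∨
      ∃ k < 3, (-(30 * 2 ^ (k + 1)) ≤ a ∧ a < -(28 * 2 ^ (k + 1))) ∨
        (-(20 * 2 ^ (k + 1)) ≤ a ∧ a < -(19 * 2 ^ (k + 1)))) → a ∈ Uset := by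
    rintro a (h | ⟨k, -, h⟩)
    · exact (mem_Uset_iff a).2 (Or.inl (by simpa using h))
    · exact (mem_Uset_iff a).2 (Or.inr ⟨k, h⟩)
  rcases h with h | h
  · exact mem_add_of_sub_mem (two_pow_mem_Vset n) (block _ h)
  · exact mem_add_of_sub_mem (neg_two_pow_mem_Vset n) (block _ h)

/-- Only summands of controlled size from `𝒱` occur in representations of `z`. -/
theorem two_pow_le_of_sub_mem_Uset {z : ℤ} {n : ℕ}
    (h : z - 2 ^ n ∈ Uset ∨ z - -2 ^ n ∈ Uset) : (2 : ℤ) ^ n ≤ 32 * |z| + 64 := by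
  by_contra! hn
  have hz₁ := le_abs_self z
  have hz₂ := neg_abs_le z
  simp only [mem_Uset_iff] at h
  rcases h with (h | ⟨k, h⟩) | (h | ⟨k, h⟩)
  · omega
  · have t := two_pow_trichotomy n (k + 5)
    have : (0 : ℤ) < 2 ^ k := by positivity
    simp only [pow_succ _ k, pow_add _ k] at *
    omega
  · omega
  · have : (0 : ℤ) < 2 ^ k := by positivity
    simp only [pow_succ _ k] at *
    omega

theorem finite_setOf_sub_mem_Uset (z : ℤ) : {v | v ∈ Vset ∧ z - v ∈ Uset}.Finite := by
  refine (Set.finite_Icc (-(32 * |z| + 64)) (32 * |z| + 64)).subset ?_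
  rintro v ⟨⟨n, rfl | rfl⟩, h⟩
  · have := two_pow_le_of_sub_mem_Uset (Or.inl h)
    have : (0 : ℤ) < 2 ^ n := by positivity
    constructor <;> linarith
  · have := two_pow_le_of_sub_mem_Uset (Or.inr h)
    have : (0 : ℤ) < 2 ^ n := by positivity
    constructor <;> linarith

theorem eq_two_pow_of_sub_mem_Uset (j : ℕ) {w : ℤ} (hw : w ∈ Vset)
    (h : 2 ^ (j + 3) - 4 - w ∈ Uset) : w = 2 ^ (j + 6) := by
  have hj : (0 : ℤ) < 2 ^ j := by positivity
  obtain ⟨n, rfl | rfl⟩ := hw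
  · have t₁ := two_pow_trichotomy n (j + 3)
    have t₂ := two_pow_trichotomy n (j + 4)
    have t₃ := two_pow_trichotomy n (j + 5)
    have t₄ := two_pow_trichotomy n (j + 6)
    rw [mem_Uset_iff] at h
    rcases h with h | ⟨k, h⟩
    · simp only [pow_add _ j] at *
      omega
    · have hk : (0 : ℤ) < 2 ^ k := by positivity
      have s₁ := two_pow_trichotomy j k
      have s₂ := two_pow_trichotomy j (k + 1)
      have s₃ := two_pow_trichotomy j (k + 2)
      have s₄ := two_pow_trichotomy n (k + 5)
      simp only [pow_add _ j, pow_add _ k] at *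
      omega
  · have hn : (0 : ℤ) < 2 ^ n := by positivity
    rw [mem_Uset_iff] at h
    rcases h with h | ⟨k, h⟩
    · simp only [pow_add _ j] at *
      omega
    · have hk : (0 : ℤ) < 2 ^ k := by positivity
      simp only [pow_add _ j, pow_add _ k] at *
      omega

theorem eq_neg_two_pow_of_sub_mem_Uset (j : ℕ) {w : ℤ} (hw : w ∈ Vset)
    (h : -(8 * 2 ^ (j + 3)) - 3 - w ∈ Uset) : w = -2 ^ (j + 3) := by
  have hj : (0 : ℤ) < 2 ^ j := by positivity
  obtain ⟨n, rfl | rfl⟩ := hw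
  all_goals
    have hn : (0 : ℤ) < 2 ^ n := by positivity
    have t₁ := two_pow_trichotomy n (j + 3)
    have t₂ := two_pow_trichotomy n (j + 4)
    have t₃ := two_pow_trichotomy n (j + 5)
    have t₄ := two_pow_trichotomy n (j + 6)
    rw [mem_Uset_iff] at h
    rcases h with h | ⟨k, h⟩
  · simp only [pow_add _ j] at *
    omega
  · have hk : (0 : ℤ) < 2 ^ k := by positivity
    have s₁ := two_pow_trichotomy (j + 3) (k + 1)
    have s₂ := two_pow_trichotomy (j + 3) (k + 2)
    have s₃ := two_pow_trichotomy n (k + 5)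
    have s₄ := two_pow_trichotomy (j + 4) (k + 1)
    simp only [pow_add _ j, pow_add _ k] at *
    omega
  · simp only [pow_add _ j] at *
    omega
  · have hk : (0 : ℤ) < 2 ^ k := by positivity
    have s₁ := two_pow_trichotomy (j + 3) (k + 1)
    have s₂ := two_pow_trichotomy (j + 3) (k + 2)
    have s₃ := two_pow_trichotomy (j + 3) (k + 3)
    simp only [pow_add _ j, pow_add _ k] at *
    omega

theorem mem_Uset_cases {a : ℤ} (ha : a ∈ Uset) (hlt : -4800 < a) :
    (a = -1 ∨ a = -2 ∨ a = -11 ∨ a = -19 ∨ a = -29 ∨ a = -30) ∨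
    ∃ k < 7, (-(30 * 2 ^ (k + 1)) ≤ a ∧ a < -(28 * 2 ^ (k + 1))) ∨
      (-(20 * 2 ^ (k + 1)) ≤ a ∧ a < -(19 * 2 ^ (k + 1))) := by
  rcases (mem_Uset_iff a).1 ha with h | ⟨k, h⟩
  · exact Or.inl h
  · refine Or.inr ⟨k, ?_, h⟩
    by_contra! hk
    have : (2 : ℤ) ^ 8 ≤ 2 ^ (k + 1) := pow_le_pow_right₀ (by norm_num) (by omega)
    omega

/-- The integers whose representations use a prescribed small element of `𝒱`. -/
theorem eq_of_sub_mem_Uset_of_small {v z : ℤ}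
    (hvz : (v, z) ∈ ({(1, -1), (-1, -2), (2, 1), (-2, -4), (4, -36), (-4, -5), (8, -11),
      (16, -24), (32, -8)} : Set (ℤ × ℤ))) {w : ℤ} (hw : w ∈ Vset) (h : z - w ∈ Uset) :
    w = v := by
  have hz : |z| ≤ 36 := by
    simp only [Set.mem_insert_iff, Set.mem_singleton_iff, Prod.mk.injEq] at hvz
    rw [abs_le]
    omega
  have hz' := abs_le.1 hz
  have bound : ∀ n : ℕ, (2 : ℤ) ^ n ≤ 32 * |z| + 64 → n < 11 := by
    intro n hn
    by_contra! h'
    have : (2 : ℤ) ^ 11 ≤ 2 ^ n := pow_le_pow_right₀ (by norm_num) h'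
    omega
  simp only [Set.mem_insert_iff, Set.mem_singleton_iff, Prod.mk.injEq] at hvz
  obtain ⟨n, rfl | rfl⟩ := hw
  · have hn := bound n (two_pow_le_of_sub_mem_Uset (Or.inl h))
    have h' : (2 : ℤ) ^ n ≤ 2 ^ 10 := pow_le_pow_right₀ (by norm_num) (by omega)
    rcases mem_Uset_cases h (by omega) with h | ⟨k, hk, h⟩
    · interval_cases n <;> omega
    · interval_cases n <;> interval_cases k <;> omega
  · have hn := bound n (two_pow_le_of_sub_mem_Uset (Or.inr h))
    have h' : (0 : ℤ) < 2 ^ n := by positivity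
    rcases mem_Uset_cases h (by omega) with h | ⟨k, hk, h⟩
    · interval_cases n <;> omega
    · interval_cases n <;> interval_cases k <;> omega

theorem exists_forced_summand {v : ℤ} (hv : v ∈ Vset) :
    ∃ z : ℤ, ∀ w ∈ Vset, z - w ∈ Uset → w = v := by
  obtain ⟨n, rfl | rfl⟩ := hv
  · match n with
    | 0 => exact ⟨-1, fun w hw h => eq_of_sub_mem_Uset_of_small (by simp) hw h⟩
    | 1 => exact ⟨1, fun w hw h => eq_of_sub_mem_Uset_of_small (by norm_num) hw h⟩
    | 2 => exact ⟨-36, fun w hw h => eq_of_sub_mem_Uset_of_small (by norm_num) hw h⟩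
    | 3 => exact ⟨-11, fun w hw h => eq_of_sub_mem_Uset_of_small (by norm_num) hw h⟩
    | 4 => exact ⟨-24, fun w hw h => eq_of_sub_mem_Uset_of_small (by norm_num) hw h⟩
    | 5 => exact ⟨-8, fun w hw h => eq_of_sub_mem_Uset_of_small (by norm_num) hw h⟩
    | j + 6 => exact ⟨_, fun w hw h => eq_two_pow_of_sub_mem_Uset j hw h⟩
  · match n with
    | 0 => exact ⟨-2, fun w hw h => eq_of_sub_mem_Uset_of_small (by norm_num) hw h⟩
    | 1 => exact ⟨-4, fun w hw h => eq_of_sub_mem_Uset_of_small (by norm_num) hw h⟩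
    | 2 => exact ⟨-5, fun w hw h => eq_of_sub_mem_Uset_of_small (by norm_num) hw h⟩
    | j + 3 => exact ⟨_, fun w hw h => eq_neg_two_pow_of_sub_mem_Uset j hw h⟩

/-- A decreasing intersection of additive complements is an additive complement, provided
every element has finitely many representations. -/
theorem iInter_add_eq_univ {G : Type*} [AddCommGroup G] {A : ℕ → Set G} {B : Set G}
    (hA : Antitone A) (hfin : ∀ z, {b | b ∈ B ∧ z - b ∈ A 0}.Finite)
    (hadd : ∀ i, A i + B = Set.univ) : (⋂ i, A i) + B = Set.univ := by
  refine Set.eq_univ_of_forall fun z => ?_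
  by_contra hz
  have hmiss : ∀ b ∈ B, ∃ i, z - b ∉ A i := by
    intro b hb
    by_contra! hall
    exact hz (Set.mem_add.2 ⟨z - b, Set.mem_iInter.2 hall, b, hb, sub_add_cancel z b⟩)
  choose! f hf using hmiss
  obtain ⟨N, hN⟩ := ((hfin z).image f).bddAbove
  obtain ⟨a, ha, b, hb, hab⟩ := Set.mem_add.1 ((hadd N).symm ▸ Set.mem_univ z)
  obtain rfl : a = z - b := eq_sub_of_add_eq hab
  have hb' : b ∈ {b | b ∈ B ∧ z - b ∈ A 0} := ⟨hb, hA (Nat.zero_le N) ha⟩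
  exact hf b hb (hA (hN (Set.mem_image_of_mem f hb')) ha)

/-- Writing `U = {−u 0, −u 1, −u 2, ...}` with `u` strictly increasing, define
`Us 0 = U` and `Us (i+1) = Us i \ {−u i}` if this is still an additive complement of
`𝒱`, and `Us (i+1) = Us i` otherwise. Then `(⋂ i, Us i, 𝒱)` is a co-minimal pair. -/
theorem inter_Useq_Vset_coMinimalPair (u : ℕ → ℤ) (hu : StrictMono u)
    (hUu : Uset = Set.range fun i => -u i)
    (Us : ℕ → Set ℤ) (hU0 : Us 0 = Uset)
    (hUstep : ∀ i : ℕ,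
      ((Us i \ {-u i}) + Vset = Set.univ ∧ Us (i + 1) = Us i \ {-u i}) ∨
      ((Us i \ {-u i}) + Vset ≠ Set.univ ∧ Us (i + 1) = Us i)) :
    IsCoMinimalPair (⋂ i, Us i) Vset := by
  have hadd : ∀ i, Us i + Vset = Set.univ := by
    intro i
    induction i with
    | zero => rw [hU0, Uset_add_Vset]
    | succ i ih =>
      rcases hUstep i with ⟨h, h'⟩ | ⟨-, h'⟩
      · rw [h', h]
      · rw [h', ih]
  have hanti : Antitone Us := by
    refine antitone_nat_of_succ_le fun i => ?_
    rcases hUstep i with ⟨-, h⟩ | ⟨-, h⟩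
    · exact h.le.trans Set.sdiff_subset
    · exact h.le
  have hsub : ⋂ i, Us i ⊆ Uset := hU0 ▸ Set.iInter_subset Us 0
  have huniv : (⋂ i, Us i) + Vset = Set.univ :=
    iInter_add_eq_univ hanti (by simpa only [hU0] using finite_setOf_sub_mem_Uset) hadd
  refine ⟨?_, ⟨_, two_pow_mem_Vset 0⟩, huniv, ?_, ?_⟩
  · exact (Set.add_nonempty.1 (huniv ▸ Set.univ_nonempty)).1
  · intro A' _ hA' hA'add
    obtain ⟨hle, x, hx, hxA'⟩ := Set.ssubset_iff_exists.1 hA'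
    obtain ⟨i, rfl⟩ : x ∈ Set.range fun i => -u i := hUu ▸ hsub hx
    rcases hUstep i with ⟨-, h⟩ | ⟨h, -⟩
    · have := Set.mem_iInter.1 hx (i + 1)
      rw [h] at this
      exact this.2 rfl
    · refine h (Set.univ_subset_iff.1 (hA'add ▸ Set.add_subset_add_right fun y hy => ⟨?_, ?_⟩))
      · exact Set.mem_iInter.1 (hle hy) i
      · rintro rfl
        exact hxA' hy
  · intro B' _ hB' hB'add
    obtain ⟨hle, v, hv, hvB'⟩ := Set.ssubset_iff_exists.1 hB'
    obtain ⟨z, hz⟩ := exists_forced_summand hv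
    obtain ⟨a, ha, w, hw, haw⟩ := Set.mem_add.1 (hB'add.symm ▸ Set.mem_univ z)
    obtain rfl : a = z - w := eq_sub_of_add_eq haw
    exact hvB' (hz w (hle hw) (hsub ha) ▸ hw)
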